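/- Let (ξ_1, …, ξ_n, ζ_1, …, ζ_n) be a centered (real or complex) Gaussian vector. Then E[:ξ_1⋯ξ_n: · :ζ_1⋯ζ_n:] = Σ_{σ ∈ S_n} Π_{i=1}^n E[ξ_i ζ_{σ(i)}], where :·: denotes Wick ordering and the sum is over all permutations σ of {1,…,n}. -/

import Mathlib

open MeasureTheory ProbabilityTheory Finset

noncomputable section

/-- The covariance `E[ξ_i ξ_j]` of two components of a random vector. -/
def cov {Ω : Type*} [MeasureSpace Ω] {n : ℕ} (ξ : Fin n → Ω → ℝ) (i j : Fin n) : ℝ :=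
  ∫ ω, ξ i ω * ξ j ω

/-- A partial pairing of `{0, …, n-1}`, encoded as a finite set of ordered pairs `(i, j)` with
`i < j`, the pairs being pairwise disjoint. -/
def IsPartialPairing {n : ℕ} (P : Finset (Fin n × Fin n)) : Prop :=
  (∀ p ∈ P, p.1 < p.2) ∧
    ∀ p ∈ P, ∀ q ∈ P, p ≠ q → p.1 ≠ q.1 ∧ p.1 ≠ q.2 ∧ p.2 ≠ q.1 ∧ p.2 ≠ q.2

/-- The set `[Π]` of indices paired by a partial pairing. -/
def paired {n : ℕ} (P : Finset (Fin n × Fin n)) : Finset (Fin n) :=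
  P.biUnion fun p => {p.1, p.2}

open scoped Classical in
/-- The Wick-ordered monomial
`:ξ_1⋯ξ_n: = Σ_Π Π_{i ∉ [Π]} ξ_i · Π_{{i,j} ∈ Π} (−E[ξ_i ξ_j])`,
summed over all partial pairings `Π` of `{1, …, n}`. -/
def wick {Ω : Type*} [MeasureSpace Ω] {n : ℕ} (ξ : Fin n → Ω → ℝ) (ω : Ω) : ℝ :=
  ∑ P ∈ Finset.univ.filter (fun P : Finset (Fin n × Fin n) => IsPartialPairing P),
    (∏ i ∈ Finset.univ \ paired P, ξ i ω) * ∏ p ∈ P, (-(cov ξ p.1 p.2))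

/-- Wick-ordered monomial over a finite set `S` of indices. -/
def wickOn {n : ℕ} {A : Type*} [CommRing A] [Algebra ℝ A] (x : Fin n → A)
    (c : Fin n → Fin n → ℝ) (S : Finset (Fin n)) : A :=
  open scoped Classical in
  ∑ P ∈ Finset.univ.filter
      (fun P : Finset (Fin n × Fin n) => IsPartialPairing P ∧ paired P ⊆ S),
    (∏ i ∈ S \ paired P, x i) * algebraMap ℝ A (∏ p ∈ P, (-(c p.1 p.2)))

theorem mem_paired {n : ℕ} {P : Finset (Fin n × Fin n)} {i : Fin n} :
    i ∈ paired P ↔ ∃ p ∈ P, i = p.1 ∨ i = p.2 := by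
  simp [paired]

theorem paired_insert {n : ℕ} (P : Finset (Fin n × Fin n)) (p : Fin n × Fin n) :
    paired (insert p P) = insert p.1 (insert p.2 (paired P)) := by
  ext i
  simp only [mem_paired, Finset.mem_insert]
  aesop

theorem IsPartialPairing.mono {n : ℕ} {P Q : Finset (Fin n × Fin n)} (hQ : IsPartialPairing Q)
    (h : P ⊆ Q) : IsPartialPairing P :=
  ⟨fun p hp => hQ.1 p (h hp), fun p hp q hq => hQ.2 p (h hp) q (h hq)⟩

theorem IsPartialPairing.insert {n : ℕ} {P : Finset (Fin n × Fin n)} (hP : IsPartialPairing P)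
    {a b : Fin n} (hab : a < b) (ha : a ∉ paired P) (hb : b ∉ paired P) :
    IsPartialPairing (insert (a, b) P) := by
  simp only [mem_paired, not_exists, not_and, not_or] at ha hb
  refine ⟨?_, ?_⟩
  · intro p hp
    rcases Finset.mem_insert.1 hp with rfl | hp
    · exact hab
    · exact hP.1 p hp
  · intro p hp q hq hpq
    rcases Finset.mem_insert.1 hp with rfl | hp <;> rcases Finset.mem_insert.1 hq with rfl | hq
    · exact absurd rfl hpq
    · exact ⟨(ha q hq).1, (ha q hq).2, (hb q hq).1, (hb q hq).2⟩
    · exact ⟨Ne.symm (ha p hp).1, Ne.symm (hb p hp).1, Ne.symm (ha p hp).2, Ne.symm (hb p hp).2⟩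
    · exact hP.2 p hp q hq hpq

theorem IsPartialPairing.not_mem_paired_erase {n : ℕ} {P : Finset (Fin n × Fin n)}
    (hP : IsPartialPairing P) {p : Fin n × Fin n} (hp : p ∈ P) :
    p.1 ∉ paired (P.erase p) ∧ p.2 ∉ paired (P.erase p) := by
  simp only [mem_paired, Finset.mem_erase, not_exists, not_and, not_or]
  constructor <;> rintro q ⟨hqp, hq⟩
  · exact ⟨(hP.2 p hp q hq hqp.symm).1, (hP.2 p hp q hq hqp.symm).2.1⟩
  · exact ⟨(hP.2 p hp q hq hqp.symm).2.2.1, (hP.2 p hp q hq hqp.symm).2.2.2⟩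

theorem wickOn_empty {n : ℕ} {A : Type*} [CommRing A] [Algebra ℝ A] (x : Fin n → A)
    (c : Fin n → Fin n → ℝ) : wickOn x c ∅ = 1 := by
  classical
  have h : Finset.univ.filter
      (fun P : Finset (Fin n × Fin n) => IsPartialPairing P ∧ paired P ⊆ ∅) = {∅} := by
    ext P
    simp only [Finset.mem_filter, Finset.mem_univ, true_and, Finset.mem_singleton]
    constructor
    · rintro ⟨-, h⟩
      refine Finset.eq_empty_of_forall_notMem fun p hp => ?_
      exact absurd (h (mem_paired.2 ⟨p, hp, Or.inl rfl⟩)) (Finset.notMem_empty _)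
    · rintro rfl
      simp [IsPartialPairing, paired]
  rw [wickOn, h]
  simp

theorem wickOn_insert {n : ℕ} {A : Type*} [CommRing A] [Algebra ℝ A] (x : Fin n → A)
    (c : Fin n → Fin n → ℝ) {a : Fin n} {S : Finset (Fin n)} (ha : ∀ b ∈ S, a < b) :
    wickOn x c (insert a S) =
      x a * wickOn x c S - ∑ b ∈ S, algebraMap ℝ A (c a b) * wickOn x c (S.erase b) := by
  classical
  have haS : a ∉ S := fun h => lt_irrefl a (ha a h)
  rw [wickOn, ← Finset.sum_filter_not_add_sum_filter _ (fun P => a ∈ paired P), sub_eq_add_neg]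
  congr 1
  · rw [wickOn, Finset.mul_sum]
    refine Finset.sum_congr ?_ fun P hP => ?_
    · ext P
      simp only [Finset.mem_filter, Finset.mem_univ, true_and]
      constructor
      · rintro ⟨⟨hP, hPS⟩, haP⟩
        exact ⟨hP, (Finset.subset_insert_iff_of_notMem haP).1 hPS⟩
      · rintro ⟨hP, hPS⟩
        exact ⟨⟨hP, hPS.trans (Finset.subset_insert _ _)⟩, fun h => haS (hPS h)⟩
    · simp only [Finset.mem_filter, Finset.mem_univ, true_and] at hP
      have haP : a ∉ paired P := fun h => haS (hP.2 h)
      rw [Finset.insert_sdiff_of_notMem _ haP, Finset.prod_insert (by simp [haS]), mul_assoc]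
  · simp only [wickOn, ← Finset.sum_neg_distrib, Finset.mul_sum]
    rw [Finset.sum_sigma']
    symm
    refine Finset.sum_bij (fun q _ => insert (a, q.1) q.2) ?_ ?_ ?_ ?_
    · rintro ⟨b, P⟩ hbP
      simp only [Finset.mem_sigma, Finset.mem_filter, Finset.mem_univ, true_and] at hbP ⊢
      obtain ⟨hb, hP, hPS⟩ := hbP
      refine ⟨⟨hP.insert (ha b hb) (fun h => haS (Finset.mem_of_mem_erase (hPS h)))
        (fun h => Finset.notMem_erase b S (hPS h)), ?_⟩, ?_⟩
      · rw [paired_insert]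
        refine Finset.insert_subset_insert _ (Finset.insert_subset hb ?_)
        exact hPS.trans (Finset.erase_subset _ _)
      · simp [paired_insert]
    · rintro ⟨b, P⟩ hbP ⟨b', P'⟩ hbP' h
      simp only [Finset.mem_sigma, Finset.mem_filter, Finset.mem_univ, true_and] at hbP hbP' h
      have haP (d : Fin n) : (a, d) ∉ P := fun hd =>
        haS (Finset.mem_of_mem_erase (hbP.2.2 (mem_paired.2 ⟨_, hd, Or.inl rfl⟩)))
      have haP' (d : Fin n) : (a, d) ∉ P' := fun hd =>
        haS (Finset.mem_of_mem_erase (hbP'.2.2 (mem_paired.2 ⟨_, hd, Or.inl rfl⟩)))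
      have hb : (a, b) ∈ insert (a, b') P' := h ▸ Finset.mem_insert_self _ _
      obtain rfl : b = b' := by
        rcases Finset.mem_insert.1 hb with hb | hb
        · exact (Prod.mk.inj hb).2
        · exact absurd hb (haP' b)
      have : P = P' := by
        rw [← Finset.erase_insert (haP b), h, Finset.erase_insert (haP' b)]
      rw [this]
    · intro P hP
      simp only [Finset.mem_filter, Finset.mem_univ, true_and] at hP
      obtain ⟨⟨hP, hPS⟩, haP⟩ := hP
      obtain ⟨⟨d, b⟩, hp, hd⟩ := mem_paired.1 haP
      have hdb : d < b := hP.1 _ hp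
      have hdS : d ∈ insert a S := hPS (mem_paired.2 ⟨_, hp, Or.inl rfl⟩)
      have hbS : b ∈ insert a S := hPS (mem_paired.2 ⟨_, hp, Or.inr rfl⟩)
      obtain rfl : a = d := by
        rcases hd with hd | rfl
        · exact hd
        · rcases Finset.mem_insert.1 hdS with hd | hd
          · exact hd.symm
          · exact absurd (ha d hd) hdb.not_gt
      have hb : b ∈ S := (Finset.mem_insert.1 hbS).resolve_left hdb.ne'
      obtain ⟨h₁, h₂⟩ := hP.not_mem_paired_erase hp
      refine ⟨⟨b, P.erase (a, b)⟩, ?_, Finset.insert_erase hp⟩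
      simp only [Finset.mem_sigma, Finset.mem_filter, Finset.mem_univ, true_and]
      refine ⟨hb, hP.mono (Finset.erase_subset _ _), fun i hi => ?_⟩
      have hiS : i ∈ insert a S := by
        obtain ⟨q, hq, hiq⟩ := mem_paired.1 hi
        exact hPS (mem_paired.2 ⟨q, Finset.mem_of_mem_erase hq, hiq⟩)
      refine Finset.mem_erase.2 ⟨fun h => h₂ (h ▸ hi), ?_⟩
      exact (Finset.mem_insert.1 hiS).resolve_left fun h => h₁ (h ▸ hi)
    · rintro ⟨b, P⟩ hbP
      simp only [Finset.mem_sigma, Finset.mem_filter, Finset.mem_univ, true_and] at hbP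
      obtain ⟨hb, hP, hPS⟩ := hbP
      have haP : (a, b) ∉ P := fun hd =>
        haS (Finset.mem_of_mem_erase (hPS (mem_paired.2 ⟨_, hd, Or.inl rfl⟩)))
      have hsd : insert a S \ paired (insert (a, b) P) = S.erase b \ paired P := by
        ext i
        simp only [paired_insert, Finset.mem_sdiff, Finset.mem_insert, Finset.mem_erase, not_or]
        constructor
        · rintro ⟨h, h1, h2, h3⟩
          exact ⟨⟨h2, h.resolve_left h1⟩, h3⟩
        · rintro ⟨⟨h2, h⟩, h3⟩
          exact ⟨Or.inr h, fun h' => haS (h' ▸ h), h2, h3⟩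
      rw [hsd, Finset.prod_insert haP, map_mul, map_neg]
      ring

theorem map_wickOn {n : ℕ} {A B : Type*} [CommRing A] [Algebra ℝ A] [CommRing B] [Algebra ℝ B]
    (f : A →ₐ[ℝ] B) (x : Fin n → A) (c : Fin n → Fin n → ℝ) (S : Finset (Fin n)) :
    f (wickOn x c S) = wickOn (fun i => f (x i)) c S := by
  simp only [wickOn, map_sum, map_mul, AlgHom.commutes, map_prod]

theorem wick_eq_wickOn {Ω : Type*} [MeasureSpace Ω] {n : ℕ} (ξ : Fin n → Ω → ℝ) (ω : Ω) :
    wick ξ ω = wickOn (fun i => ξ i ω) (cov ξ) Finset.univ := by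
  rw [wick, wickOn]
  exact Finset.sum_congr (by ext; simp) fun P _ => rfl

/-- Derivations act on Wick monomials as on ordinary multilinear monomials. -/
theorem derivation_wickOn {n : ℕ} {A : Type*} [CommRing A] [Algebra ℝ A] (D : Derivation ℝ A A)
    (x : Fin n → A) (c : Fin n → Fin n → ℝ) (d : Fin n → ℝ)
    (hD : ∀ i, D (x i) = algebraMap ℝ A (d i)) (S : Finset (Fin n)) :
    D (wickOn x c S) = ∑ b ∈ S, algebraMap ℝ A (d b) * wickOn x c (S.erase b) := by
  induction S using Finset.strongInduction with
  | H S ih =>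
    rcases S.eq_empty_or_nonempty with rfl | hS
    · simp [wickOn_empty]
    obtain ⟨a, S, ha, rfl⟩ : ∃ a T, (∀ b ∈ T, a < b) ∧ S = insert a T :=
      ⟨S.min' hS, S.erase (S.min' hS), fun b hb => S.min'_lt_of_mem_erase_min' hS hb,
        (Finset.insert_erase (S.min'_mem hS)).symm⟩
    have haS : a ∉ S := fun h => lt_irrefl a (ha a h)
    have hlt : S ⊂ insert a S := Finset.ssubset_insert haS
    have hR : ∀ b ∈ S, wickOn x c ((insert a S).erase b) =
        x a * wickOn x c (S.erase b) -
          ∑ e ∈ S.erase b, algebraMap ℝ A (c a e) * wickOn x c ((S.erase b).erase e) := by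
      intro b hb
      rw [Finset.erase_insert_of_ne (ha b hb).ne,
        wickOn_insert x c fun e he => ha e (Finset.mem_of_mem_erase he)]
    have hL : ∀ b ∈ S, D (wickOn x c (S.erase b)) =
        ∑ e ∈ S.erase b, algebraMap ℝ A (d e) * wickOn x c ((S.erase b).erase e) :=
      fun b _ => ih _ ((Finset.erase_subset _ _).trans_ssubset hlt)
    have hswap : ∑ b ∈ S, algebraMap ℝ A (c a b) *
          ∑ e ∈ S.erase b, algebraMap ℝ A (d e) * wickOn x c ((S.erase b).erase e) =
        ∑ b ∈ S, algebraMap ℝ A (d b) *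
          ∑ e ∈ S.erase b, algebraMap ℝ A (c a e) * wickOn x c ((S.erase b).erase e) := by
      simp only [Finset.mul_sum]
      rw [Finset.sum_comm' (t' := S) (s' := fun e => S.erase e)]
      · refine Finset.sum_congr rfl fun b _ => Finset.sum_congr rfl fun e _ => ?_
        rw [Finset.erase_right_comm]
        ring
      · intro b e
        simp only [Finset.mem_erase]
        tauto
    rw [wickOn_insert x c ha, Finset.sum_insert haS, Finset.erase_insert haS, map_sub,
      Derivation.leibniz, hD, ih S hlt, map_sum]
    simp only [Derivation.leibniz, Derivation.map_algebraMap, smul_eq_mul, mul_zero, add_zero]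
    have h₁ : ∑ b ∈ S, algebraMap ℝ A (c a b) * D (wickOn x c (S.erase b)) =
        ∑ b ∈ S, algebraMap ℝ A (d b) *
          ∑ e ∈ S.erase b, algebraMap ℝ A (c a e) * wickOn x c ((S.erase b).erase e) := by
      rw [← hswap]
      exact Finset.sum_congr rfl fun b hb => by rw [hL b hb]
    have h₂ : ∑ b ∈ S, algebraMap ℝ A (d b) * wickOn x c ((insert a S).erase b) =
        x a * (∑ b ∈ S, algebraMap ℝ A (d b) * wickOn x c (S.erase b)) -
          ∑ b ∈ S, algebraMap ℝ A (d b) *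
            ∑ e ∈ S.erase b, algebraMap ℝ A (c a e) * wickOn x c ((S.erase b).erase e) := by
      rw [Finset.mul_sum, ← Finset.sum_sub_distrib]
      refine Finset.sum_congr rfl fun b hb => ?_
      rw [hR b hb]
      ring
    rw [h₁, h₂]
    ring

open MvPolynomial in
/-- Coordinates of a centered Gaussian vector have polynomial moments of all orders. -/
theorem memLp_aeval_of_gaussian {ι Ω : Type*} [Fintype ι] [MeasurableSpace Ω] {μ : Measure Ω}
    [IsProbabilityMeasure μ] {Y : ι → Ω → ℝ} (hY : ∀ i, Measurable (Y i))
    (hG : ∀ t : ι → ℝ, ∃ v : NNReal, μ.map (fun ω => ∑ i, t i * Y i ω) = gaussianReal 0 v)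
    (p : MvPolynomial ι ℝ) (q : NNReal) :
    MemLp (fun ω => aeval (fun i => Y i ω) p) q μ := by
  classical
  have hYL : ∀ i (q : NNReal), MemLp (Y i) q μ := by
    intro i q
    obtain ⟨v, hv⟩ := hG (Pi.single i 1)
    simp only [Pi.single_apply, ite_mul, one_mul, zero_mul, Finset.sum_ite_eq',
      Finset.mem_univ, if_true] at hv
    have h := memLp_id_gaussianReal (μ := 0) (v := v) q
    rw [← hv] at h
    exact (memLp_map_measure_iff aestronglyMeasurable_id (hY i).aemeasurable).1 h
  induction p using MvPolynomial.induction_on generalizing q with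
  | C r => simpa using memLp_const r
  | add p p' hp hp' =>
    simp only [map_add]
    exact (hp q).add (hp' q)
  | mul_X p i hp =>
    simp only [map_mul, aeval_X]
    have : ENNReal.HolderTriple ((2 * q : NNReal) : ENNReal) ((2 * q : NNReal) : ENNReal) q := by
      constructor
      rw [ENNReal.coe_mul, ENNReal.mul_inv (by simp) (by simp), ← two_mul, ← mul_assoc]
      norm_num
      rw [ENNReal.mul_inv_cancel (by simp) (by simp), one_mul]
    exact MemLp.mul' (hYL i (2 * q)) (hp (2 * q))

theorem charFun_of_gaussian {ι Ω : Type*} [Fintype ι] [MeasurableSpace Ω] {μ : Measure Ω}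
    [IsProbabilityMeasure μ] {Y : ι → Ω → ℝ} (hY : ∀ i, Measurable (Y i))
    (hG : ∀ t : ι → ℝ, ∃ v : NNReal, μ.map (fun ω => ∑ i, t i * Y i ω) = gaussianReal 0 v)
    (t : ι → ℝ) :
    ∫ ω, Complex.exp (((∑ i, t i * Y i ω : ℝ) : ℂ) * Complex.I) ∂μ =
      Complex.exp ((-(1 / 2) * ∑ i, ∑ j, t i * t j * ∫ ω, Y i ω * Y j ω ∂μ : ℝ) : ℂ) := by
  obtain ⟨v, hv⟩ := hG t
  have hm : Measurable fun ω => ∑ i, t i * Y i ω := by fun_prop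
  have hvar : ∑ i, ∑ j, t i * t j * ∫ ω, Y i ω * Y j ω ∂μ = v := by
    have h := variance_id_gaussianReal (μ := 0) (v := v)
    rw [variance_of_integral_eq_zero aemeasurable_id (by simp), ← hv,
      integral_map hm.aemeasurable (by fun_prop)] at h
    rw [← h]
    have hint : ∀ i j, Integrable (fun ω => t i * t j * (Y i ω * Y j ω)) μ := fun i j => by
      have := memLp_aeval_of_gaussian hY hG (MvPolynomial.X i * MvPolynomial.X j) 1
      simp only [map_mul, MvPolynomial.aeval_X, ENNReal.coe_one, memLp_one_iff_integrable] at this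
      exact this.const_mul _
    simp only [id, sq, Finset.sum_mul_sum]
    rw [integral_finsetSum _ fun i _ => integrable_finsetSum _ fun j _ => by
      simpa only [mul_mul_mul_comm] using hint i j]
    refine Finset.sum_congr rfl fun i _ => ?_
    rw [integral_finsetSum _ fun j _ => by simpa only [mul_mul_mul_comm] using hint i j]
    refine Finset.sum_congr rfl fun j _ => ?_
    rw [← integral_const_mul]
    simp only [mul_mul_mul_comm]
  have h := charFun_gaussianReal (μ := 0) (v := v) 1
  rw [← hv, charFun_apply_real, integral_map hm.aemeasurable (by fun_prop)] at h
  rw [hvar]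
  simp only [Complex.ofReal_one, one_mul] at h
  rw [h]
  congr 1
  push_cast
  ring

open MvPolynomial in
theorem hasDerivAt_integral_aeval_mul_cexp {ι Ω : Type*} [Fintype ι] [DecidableEq ι]
    [MeasurableSpace Ω] {μ : Measure Ω} {Y : ι → Ω → ℝ} (hY : ∀ i, Measurable (Y i))
    (hint : ∀ p : MvPolynomial ι ℝ, Integrable (fun ω => aeval (fun i => Y i ω) p) μ)
    (p : MvPolynomial ι ℝ) (t : ι → ℝ) (b : ι) :
    HasDerivAt (fun s : ℝ => ∫ ω, ((aeval (fun i => Y i ω) p : ℝ) : ℂ) *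
        Complex.exp (((∑ i, (t + Pi.single b s : ι → ℝ) i * Y i ω : ℝ) : ℂ) * Complex.I) ∂μ)
      (Complex.I * ∫ ω, ((aeval (fun i => Y i ω) (p * X b) : ℝ) : ℂ) *
        Complex.exp (((∑ i, t i * Y i ω : ℝ) : ℂ) * Complex.I) ∂μ) 0 := by
  have hsum : ∀ (s : ℝ) ω, ∑ i, (t + Pi.single b s : ι → ℝ) i * Y i ω =
      ∑ i, t i * Y i ω + s * Y b ω := by
    intro s ω
    simp [add_mul, Finset.sum_add_distrib, Pi.single_apply]
  simp only [hsum]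
  have hmeas : ∀ p : MvPolynomial ι ℝ, AEStronglyMeasurable
      (fun ω => ((aeval (fun i => Y i ω) p : ℝ) : ℂ)) μ := fun p =>
    Complex.continuous_ofReal.comp_aestronglyMeasurable (hint p).1
  have hexp : ∀ s : ℝ, AEStronglyMeasurable (fun ω =>
      Complex.exp (((∑ i, t i * Y i ω + s * Y b ω : ℝ) : ℂ) * Complex.I)) μ := fun s => by
    have : Measurable fun ω => ∑ i, t i * Y i ω + s * Y b ω := by fun_prop
    exact Measurable.aestronglyMeasurable (by fun_prop)
  have hdiff : ∀ ω (s : ℝ), HasDerivAt (fun s : ℝ => ((aeval (fun i => Y i ω) p : ℝ) : ℂ) *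
        Complex.exp (((∑ i, t i * Y i ω + s * Y b ω : ℝ) : ℂ) * Complex.I))
      (Complex.I * (((aeval (fun i => Y i ω) (p * X b) : ℝ) : ℂ) *
        Complex.exp (((∑ i, t i * Y i ω + s * Y b ω : ℝ) : ℂ) * Complex.I))) s := by
    intro ω s
    have h₁ : HasDerivAt (fun s : ℝ => ∑ i, t i * Y i ω + s * Y b ω) (Y b ω) s := by
      simpa using ((hasDerivAt_id s).mul_const (Y b ω)).const_add (∑ i, t i * Y i ω)
    have h₂ := ((h₁.ofReal_comp.mul_const Complex.I).cexp).const_mul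
      ((aeval (fun i => Y i ω) p : ℝ) : ℂ)
    refine h₂.congr_deriv ?_
    rw [map_mul, aeval_X, Complex.ofReal_mul]
    ring
  have key := hasDerivAt_integral_of_dominated_loc_of_deriv_le (μ := μ) (x₀ := (0 : ℝ))
    (F := fun s ω => ((aeval (fun i => Y i ω) p : ℝ) : ℂ) *
        Complex.exp (((∑ i, t i * Y i ω + s * Y b ω : ℝ) : ℂ) * Complex.I))
    (F' := fun s ω => Complex.I * (((aeval (fun i => Y i ω) (p * X b) : ℝ) : ℂ) *
        Complex.exp (((∑ i, t i * Y i ω + s * Y b ω : ℝ) : ℂ) * Complex.I)))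
    (bound := fun ω => ‖aeval (fun i => Y i ω) (p * X b)‖) (s := Set.univ) Filter.univ_mem
    (Filter.Eventually.of_forall fun s => (hmeas p).mul (hexp s))
    ((hint p).mono ((hmeas p).mul (hexp 0)) (Filter.Eventually.of_forall fun ω => by
      rw [norm_mul, Complex.norm_exp_ofReal_mul_I, mul_one, Complex.norm_real]))
    (((hmeas (p * X b)).mul (hexp 0)).const_mul _)
    (Filter.Eventually.of_forall fun ω s _ => by
      rw [norm_mul, norm_mul, Complex.norm_exp_ofReal_mul_I, Complex.norm_I, one_mul, mul_one,
        Complex.norm_real])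
    (hint (p * X b)).norm
    (Filter.Eventually.of_forall fun ω s _ => hdiff ω s)
  have h := key.2
  simp only [zero_mul, add_zero] at h
  rwa [integral_const_mul] at h

theorem hasDerivAt_add_single_apply {ι : Type*} [DecidableEq ι] (t : ι → ℝ) (a i : ι) :
    HasDerivAt (fun s : ℝ => (t + Pi.single a s : ι → ℝ) i) ((Pi.single a 1 : ι → ℝ) i) 0 := by
  simp only [Pi.add_apply, Pi.single_apply]
  split_ifs
  · exact (hasDerivAt_id (0 : ℝ)).const_add (t i)
  · simpa using hasDerivAt_const (0 : ℝ) (t i + 0)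

theorem hasDerivAt_quadratic_add_single {ι : Type*} [Fintype ι] [DecidableEq ι] {c : ι → ι → ℝ}
    (hc : ∀ i j, c i j = c j i) (t : ι → ℝ) (a : ι) :
    HasDerivAt (fun s : ℝ => ∑ i, ∑ j,
        (t + Pi.single a s : ι → ℝ) i * (t + Pi.single a s : ι → ℝ) j * c i j)
      (2 * ∑ i, t i * c a i) 0 := by
  have h := HasDerivAt.fun_sum (u := Finset.univ) fun i _ =>
    HasDerivAt.fun_sum (u := Finset.univ) fun j _ =>
    (((hasDerivAt_add_single_apply t a i).mul (hasDerivAt_add_single_apply t a j)).mul_const (c i j))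
  refine h.congr_deriv ?_
  simp only [Pi.single_zero, add_zero, Pi.single_apply, add_mul, Finset.sum_add_distrib, ite_mul,
    mul_ite, one_mul, mul_one, zero_mul, mul_zero, Finset.sum_ite_irrel, Finset.sum_const_zero,
    Finset.sum_ite_eq', Finset.mem_univ, if_true, hc _ a]
  ring

open MvPolynomial in
theorem integral_mul_cexp_of_gaussian {ι Ω : Type*} [Fintype ι] [MeasurableSpace Ω]
    {μ : Measure Ω} [IsProbabilityMeasure μ] {Y : ι → Ω → ℝ} (hY : ∀ i, Measurable (Y i))
    (hG : ∀ t : ι → ℝ, ∃ v : NNReal, μ.map (fun ω => ∑ i, t i * Y i ω) = gaussianReal 0 v)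
    (a : ι) (t : ι → ℝ) :
    ∫ ω, (Y a ω : ℂ) * Complex.exp (((∑ i, t i * Y i ω : ℝ) : ℂ) * Complex.I) ∂μ =
      Complex.I * ((∑ i, t i * ∫ ω, Y a ω * Y i ω ∂μ : ℝ) : ℂ) *
        ∫ ω, Complex.exp (((∑ i, t i * Y i ω : ℝ) : ℂ) * Complex.I) ∂μ := by
  classical
  have hint : ∀ p : MvPolynomial ι ℝ, Integrable (fun ω => aeval (fun i => Y i ω) p) μ :=
    fun p => memLp_one_iff_integrable.1 (by simpa using memLp_aeval_of_gaussian hY hG p 1)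
  have h₁ := hasDerivAt_integral_aeval_mul_cexp hY hint 1 t a
  simp only [map_one, Complex.ofReal_one, one_mul, aeval_X, charFun_of_gaussian hY hG] at h₁
  have h₂ := ((hasDerivAt_quadratic_add_single (c := fun i j => ∫ ω, Y i ω * Y j ω ∂μ)
    (fun i j => by simp only [mul_comm]) t a).const_mul (-(1 / 2))).ofReal_comp.cexp
  have h := h₁.unique h₂
  simp only [Pi.single_zero, add_zero] at h
  rw [charFun_of_gaussian hY hG]
  refine mul_left_cancel₀ Complex.I_ne_zero (h.trans ?_)
  push_cast
  linear_combination -(∑ i, (t i : ℂ) * ((∫ ω, Y a ω * Y i ω ∂μ : ℝ) : ℂ)) *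
    Complex.exp (-(1 / 2) * ∑ i, ∑ j, (t i : ℂ) * (t j : ℂ) * ((∫ ω, Y i ω * Y j ω ∂μ : ℝ) : ℂ)) *
    Complex.I_mul_I

open MvPolynomial in
/-- Gaussian integration by parts against a character. -/
theorem integral_aeval_X_mul_cexp_of_gaussian {ι Ω : Type*} [Fintype ι] [MeasurableSpace Ω]
    {μ : Measure Ω} [IsProbabilityMeasure μ] {Y : ι → Ω → ℝ} (hY : ∀ i, Measurable (Y i))
    (hG : ∀ t : ι → ℝ, ∃ v : NNReal, μ.map (fun ω => ∑ i, t i * Y i ω) = gaussianReal 0 v)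
    (a : ι) (p : MvPolynomial ι ℝ) (t : ι → ℝ) :
    ∫ ω, ((aeval (fun i => Y i ω) (X a * p) : ℝ) : ℂ) *
        Complex.exp (((∑ i, t i * Y i ω : ℝ) : ℂ) * Complex.I) ∂μ =
      Complex.I * ((∑ i, t i * ∫ ω, Y a ω * Y i ω ∂μ : ℝ) : ℂ) *
          ∫ ω, ((aeval (fun i => Y i ω) p : ℝ) : ℂ) *
            Complex.exp (((∑ i, t i * Y i ω : ℝ) : ℂ) * Complex.I) ∂μ +
        ∫ ω, ((aeval (fun i => Y i ω)
            (mkDerivation ℝ (fun i => C (∫ ω, Y a ω * Y i ω ∂μ)) p) : ℝ) : ℂ) *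
          Complex.exp (((∑ i, t i * Y i ω : ℝ) : ℂ) * Complex.I) ∂μ := by
  classical
  set c : ι → ι → ℝ := fun i j => ∫ ω, Y i ω * Y j ω ∂μ
  set D : Derivation ℝ (MvPolynomial ι ℝ) (MvPolynomial ι ℝ) :=
    mkDerivation ℝ (fun i => C (c a i)) with hDdef
  have hint : ∀ p : MvPolynomial ι ℝ, Integrable (fun ω => aeval (fun i => Y i ω) p) μ :=
    fun p => memLp_one_iff_integrable.1 (by simpa using memLp_aeval_of_gaussian hY hG p 1)
  have hintexp : ∀ (p : MvPolynomial ι ℝ) (t : ι → ℝ), Integrable (fun ω =>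
      ((aeval (fun i => Y i ω) p : ℝ) : ℂ) *
        Complex.exp (((∑ i, t i * Y i ω : ℝ) : ℂ) * Complex.I)) μ := by
    intro p t
    have : Measurable fun ω => ∑ i, t i * Y i ω := by fun_prop
    have hm : AEStronglyMeasurable (fun ω =>
      Complex.exp (((∑ i, t i * Y i ω : ℝ) : ℂ) * Complex.I)) μ :=
        Measurable.aestronglyMeasurable (by fun_prop)
    refine (hint p).mono ((Complex.continuous_ofReal.comp_aestronglyMeasurable (hint p).1).mul hm)
      (Filter.Eventually.of_forall fun ω => ?_)
    rw [norm_mul, Complex.norm_exp_ofReal_mul_I, mul_one, Complex.norm_real]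
  have hderiv_lin : ∀ (b : ι) (t : ι → ℝ), HasDerivAt
      (fun s : ℝ => ((∑ i, (t + Pi.single b s : ι → ℝ) i * c a i : ℝ) : ℂ)) (c a b : ℂ) 0 := by
    intro b t
    have h := HasDerivAt.fun_sum (u := Finset.univ) fun i _ =>
      (hasDerivAt_add_single_apply t b i).mul_const (c a i)
    simpa [Pi.single_apply] using h.ofReal_comp
  have hone := integral_mul_cexp_of_gaussian hY hG a
  obtain ⟨J, hJ⟩ : ∃ J : MvPolynomial ι ℝ → (ι → ℝ) → ℂ, ∀ p t, J p t =
      ∫ ω, ((aeval (fun i => Y i ω) p : ℝ) : ℂ) *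
        Complex.exp (((∑ i, t i * Y i ω : ℝ) : ℂ) * Complex.I) ∂μ := ⟨_, fun _ _ => rfl⟩
  have hadd : ∀ p q t, J (p + q) t = J p t + J q t := by
    intro p q t
    rw [hJ, hJ, hJ, ← integral_add (hintexp p t) (hintexp q t)]
    simp only [map_add, Complex.ofReal_add, add_mul]
  have hsmul : ∀ (r : ℝ) p t, J (C r * p) t = r * J p t := by
    intro r p t
    rw [hJ, hJ, ← integral_const_mul]
    simp [mul_assoc]
  have hderiv : ∀ p t b, HasDerivAt (fun s : ℝ => J p (t + Pi.single b s))
      (Complex.I * J (p * X b) t) 0 := by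
    intro p t b
    simp only [hJ]
    exact hasDerivAt_integral_aeval_mul_cexp hY hint p t b
  have hX : ∀ t, J (X a) t = Complex.I * ((∑ i, t i * c a i : ℝ) : ℂ) * J 1 t := by
    intro t
    rw [hJ, hJ]
    simpa only [aeval_X, map_one, Complex.ofReal_one, one_mul] using hone t
  change _ = Complex.I * ((∑ i, t i * c a i : ℝ) : ℂ) * _ + _
  rw [← hJ, ← hJ, ← hJ]
  clear_value D c
  clear hJ hone hintexp hint
  induction p using MvPolynomial.induction_on generalizing t with
  | C r =>
    have h₁ := hsmul r (X a) t
    have h₂ := hsmul r 1 t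
    have h₃ := hsmul 0 0 t
    simp only [mul_zero, Complex.ofReal_zero, zero_mul] at h₃
    rw [mul_one] at h₂
    rw [mul_comm (X a) (C r), h₁, h₂, hX t, hDdef, derivation_C, h₃]
    ring
  | add p q hp hq =>
    rw [mul_add, hadd, hadd, map_add, hadd, hp, hq]
    ring
  | mul_X p b hp =>
    have h₁ := hderiv (X a * p) t b
    have h₂ := (((hderiv_lin b t).const_mul Complex.I).fun_mul (hderiv p t b)).fun_add
      (hderiv (D p) t b)
    rw [show (fun s : ℝ => J (X a * p) (t + Pi.single b s)) = _ from
      funext fun s => hp (t + Pi.single b s)] at h₁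
    have h₃ := h₁.unique h₂
    have hDp : D (p * X b) = C (c a b) * p + D p * X b := by
      rw [Derivation.leibniz, hDdef, mkDerivation_X]
      simp only [smul_eq_mul]
      ring
    rw [hDp, hadd, hsmul, ← mul_assoc]
    simp only [Pi.single_zero, add_zero] at h₃
    refine mul_left_cancel₀ Complex.I_ne_zero ?_
    rw [h₃]
    ring

open MvPolynomial in
/-- Gaussian integration by parts for polynomials. -/
theorem integral_aeval_X_mul_of_gaussian {ι Ω : Type*} [Fintype ι] [MeasurableSpace Ω]
    {μ : Measure Ω} [IsProbabilityMeasure μ] {Y : ι → Ω → ℝ} (hY : ∀ i, Measurable (Y i))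
    (hG : ∀ t : ι → ℝ, ∃ v : NNReal, μ.map (fun ω => ∑ i, t i * Y i ω) = gaussianReal 0 v)
    (a : ι) (p : MvPolynomial ι ℝ) :
    ∫ ω, aeval (fun i => Y i ω) (X a * p) ∂μ =
      ∫ ω, aeval (fun i => Y i ω)
        (mkDerivation ℝ (fun i => C (∫ ω, Y a ω * Y i ω ∂μ)) p) ∂μ := by
  have h := integral_aeval_X_mul_cexp_of_gaussian hY hG a p 0
  simp only [Pi.zero_apply, zero_mul, Finset.sum_const_zero, Complex.ofReal_zero, mul_zero,
    Complex.exp_zero, mul_one, zero_add] at h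
  rw [integral_complex_ofReal, integral_complex_ofReal] at h
  exact_mod_cast h

open MvPolynomial in
/-- A linear functional obeying Gaussian integration by parts pairs two Wick monomials through
permutations of the cross-covariances. -/
theorem functional_wickOn_mul_wickOn {n : ℕ} (E : MvPolynomial (Fin n ⊕ Fin n) ℝ →ₗ[ℝ] ℝ)
    (hE : E 1 = 1) (K : Fin n ⊕ Fin n → Fin n ⊕ Fin n → ℝ)
    (hIBP : ∀ a p, E (X a * p) = E (mkDerivation ℝ (fun i => C (K a i)) p))
    (k : ℕ) (f g : Fin k → Fin n) (hf : StrictMono f) (hg : Function.Injective g) :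
    E (wickOn (fun i => X (Sum.inl i)) (fun i j => K (Sum.inl i) (Sum.inl j))
        (Finset.univ.image f) *
      wickOn (fun i => X (Sum.inr i)) (fun i j => K (Sum.inr i) (Sum.inr j))
        (Finset.univ.image g)) =
    ∑ σ : Equiv.Perm (Fin k), ∏ i, K (Sum.inl (f i)) (Sum.inr (g (σ i))) := by
  induction k with
  | zero => simp [wickOn_empty, hE]
  | succ k ih =>
    set V : Finset (Fin n) → MvPolynomial (Fin n ⊕ Fin n) ℝ :=
      wickOn (fun i => X (Sum.inl i)) (fun i j => K (Sum.inl i) (Sum.inl j))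
    set W : Finset (Fin n) → MvPolynomial (Fin n ⊕ Fin n) ℝ :=
      wickOn (fun i => X (Sum.inr i)) (fun i j => K (Sum.inr i) (Sum.inr j))
    have himf : Finset.univ.image f =
        insert (f 0) (Finset.univ.image fun i : Fin k => f i.succ) := by
      ext i
      simp [Fin.exists_fin_succ, eq_comm]
    have himg : ∀ j, (Finset.univ.image g).erase (g j) =
        Finset.univ.image fun i : Fin k => g (Equiv.swap 0 j i.succ) := by
      intro j
      ext i
      simp only [Finset.mem_erase, Finset.mem_image, Finset.mem_univ, true_and]
      constructor
      · rintro ⟨hij, l, rfl⟩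
        have hl : Equiv.swap 0 j l ≠ 0 := by
          intro h
          rw [Equiv.swap_apply_eq_iff, Equiv.swap_apply_left] at h
          exact hij (h ▸ rfl)
        exact ⟨(Equiv.swap 0 j l).pred hl, by simp⟩
      · rintro ⟨l, rfl⟩
        refine ⟨fun h => ?_, _, rfl⟩
        have := hg h
        rw [Equiv.swap_apply_eq_iff, Equiv.swap_apply_right] at this
        exact Fin.succ_ne_zero l this
    set S := Finset.univ.image fun i : Fin k => f i.succ
    set D : Derivation ℝ (MvPolynomial (Fin n ⊕ Fin n) ℝ) (MvPolynomial (Fin n ⊕ Fin n) ℝ) :=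
      mkDerivation ℝ (fun i => C (K (Sum.inl (f 0)) i)) with hD
    have hDV : D (V S) =
        ∑ b ∈ S, algebraMap ℝ _ (K (Sum.inl (f 0)) (Sum.inl b)) * V (S.erase b) :=
      derivation_wickOn D _ _ _ (fun i => mkDerivation_X _ _ _) S
    have hDW : D (W (Finset.univ.image g)) = ∑ b ∈ Finset.univ.image g,
        algebraMap ℝ _ (K (Sum.inl (f 0)) (Sum.inr b)) * W ((Finset.univ.image g).erase b) :=
      derivation_wickOn D _ _ _ (fun i => mkDerivation_X _ _ _) _
    have hrec : E (V (insert (f 0) S) * W (Finset.univ.image g)) =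
        E (V S * D (W (Finset.univ.image g))) := by
      have h₀ : V (insert (f 0) S) = X (Sum.inl (f 0)) * V S - D (V S) := by
        rw [hDV]
        refine wickOn_insert _ _ fun b hb => ?_
        obtain ⟨i, -, rfl⟩ := Finset.mem_image.1 hb
        exact hf (Fin.succ_pos i)
      rw [h₀, sub_mul, map_sub, mul_assoc, hIBP, ← hD, Derivation.leibniz, map_add, smul_eq_mul,
        smul_eq_mul, mul_comm (D (V S)), add_sub_cancel_right]
    rw [himf, hrec, hDW, Finset.sum_image hg.injOn, Finset.mul_sum, map_sum,
      ← Equiv.sum_comp Equiv.Perm.decomposeFin.symm, Fintype.sum_prod_type]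
    refine Finset.sum_congr rfl fun j _ => ?_
    have hj := ih (fun i => f i.succ) (fun i => g (Equiv.swap 0 j i.succ))
      (hf.comp Fin.strictMono_succ)
      (hg.comp ((Equiv.injective _).comp (Fin.succ_injective k)))
    rw [mul_left_comm, ← Algebra.smul_def, map_smul, himg, hj, smul_eq_mul, Finset.mul_sum]
    refine Finset.sum_congr rfl fun σ _ => ?_
    rw [Fin.prod_univ_succ]
    simp only [Equiv.Perm.decomposeFin_symm_apply_zero, Equiv.Perm.decomposeFin_symm_apply_succ]

/-- Two-block Wick rule: for a centered (jointly) Gaussian vector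
`(ξ_1, …, ξ_n, ζ_1, …, ζ_n)`,
`E[:ξ_1⋯ξ_n: :ζ_1⋯ζ_n:] = Σ_{σ ∈ S_n} Π_i E[ξ_i ζ_{σ(i)}]`. -/
theorem wick_two_blocks {Ω : Type*} [MeasureSpace Ω] [IsProbabilityMeasure (volume : Measure Ω)]
    (n : ℕ) (ξ ζ : Fin n → Ω → ℝ)
    (hmeasξ : ∀ i, Measurable (ξ i)) (hmeasζ : ∀ i, Measurable (ζ i))
    (hcenteredξ : ∀ i, ∫ ω, ξ i ω = 0) (hcenteredζ : ∀ i, ∫ ω, ζ i ω = 0)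
    (hgauss : ∀ c d : Fin n → ℝ, ∃ var : NNReal,
      Measure.map (fun ω => (∑ i, c i * ξ i ω) + ∑ i, d i * ζ i ω) volume =
        gaussianReal 0 var) :
    ∫ ω, wick ξ ω * wick ζ ω =
      ∑ σ : Equiv.Perm (Fin n), ∏ i, ∫ ω, ξ i ω * ζ (σ i) ω := by
  have hY : ∀ i, Measurable (Sum.elim ξ ζ i) := by
    rintro (i | i)
    exacts [hmeasξ i, hmeasζ i]
  have hG : ∀ t : Fin n ⊕ Fin n → ℝ, ∃ v : NNReal,
      (volume : Measure Ω).map (fun ω => ∑ i, t i * Sum.elim ξ ζ i ω) = gaussianReal 0 v := by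
    intro t
    simpa [Fintype.sum_sum_type] using hgauss (fun i => t (Sum.inl i)) (fun i => t (Sum.inr i))
  have hint : ∀ p : MvPolynomial (Fin n ⊕ Fin n) ℝ,
      Integrable (fun ω => MvPolynomial.aeval (fun i => Sum.elim ξ ζ i ω) p) :=
    fun p => memLp_one_iff_integrable.1 (by simpa using memLp_aeval_of_gaussian hY hG p 1)
  let E : MvPolynomial (Fin n ⊕ Fin n) ℝ →ₗ[ℝ] ℝ :=
    { toFun := fun p => ∫ ω, MvPolynomial.aeval (fun i => Sum.elim ξ ζ i ω) p
      map_add' := fun p q => by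
        simp only [map_add]
        exact integral_add (hint p) (hint q)
      map_smul' := fun r p => by
        simp only [map_smul, smul_eq_mul, integral_const_mul, RingHom.id_apply] }
  have h := functional_wickOn_mul_wickOn E (by simp [E])
    (fun i j => ∫ ω, Sum.elim ξ ζ i ω * Sum.elim ξ ζ j ω)
    (fun a p => integral_aeval_X_mul_of_gaussian hY hG a p) n id id strictMono_id
    Function.injective_id
  simp only [E, LinearMap.coe_mk, AddHom.coe_mk, Finset.image_id, map_mul, map_wickOn,
    MvPolynomial.aeval_X, Sum.elim_inl, Sum.elim_inr, id] at h
  simp only [wick_eq_wickOn]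
  exact h

end
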